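/- arXiv:1707.01851 — 2 statements merged into one kernel-verified Lean document; each statement's English description precedes it below -/
import Mathlib

section
/- Let 0 ≤ m ≤ n and 1 ≤ i ≤ m. If the image of i in I is not equal to κ₂−κ₁+1, then y_i·(ψ_i ψ_{i+1} ⋯ ψ_m)·z_m = 0 in S_m. -/
namespace KLRHook

/-- Generators of the cyclotomic Khovanov--Lauda--Rouquier algebra in level two:
idempotents `E i` for residue sequences `i`, dots `Y r` (1-indexed, `1 ≤ r ≤ n`)
and crossings `Psi r` (1-indexed, `1 ≤ r ≤ n - 1`). -/
inductive Gen (e n : ℕ) : Type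
  | E : (Fin n → ZMod e) → Gen e n
  | Y : ℕ → Gen e n
  | Psi : ℕ → Gen e n

variable (F : Type*) [Field F] (e n : ℕ) [NeZero e] (κ₁ κ₂ : ZMod e)

/-- The entry of a residue sequence at the 1-indexed position `r` (junk value `0` out of
range). -/
def ent (i : Fin n → ZMod e) (r : ℕ) : ZMod e :=
  if h : 1 ≤ r ∧ r ≤ n then i ⟨r - 1, by omega⟩ else 0

/-- Swap the entries of a residue sequence at the 1-indexed positions `r` and `r + 1`. -/
def swapIdx (r : ℕ) (i : Fin n → ZMod e) : Fin n → ZMod e := fun k =>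
  if (k : ℕ) + 1 = r then ent e n i (r + 1)
  else if (k : ℕ) = r then ent e n i r
  else i k

/-- The free algebra on the KLR generators. -/
abbrev FreeH := FreeAlgebra F (Gen e n)

def fE (i : Fin n → ZMod e) : FreeH F e n := FreeAlgebra.ι F (Gen.E i)
def fY (r : ℕ) : FreeH F e n := FreeAlgebra.ι F (Gen.Y r)
def fPsi (r : ℕ) : FreeH F e n := FreeAlgebra.ι F (Gen.Psi r)

/-- The Kronecker delta `δ_{i_r, i_{r+1}}` as a scalar `0` or `1`. -/
def fDelta (i : Fin n → ZMod e) (r : ℕ) : FreeH F e n :=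
  if ent e n i r = ent e n i (r + 1) then 1 else 0

/-- The exponent `(Λ, α_j)` in the cyclotomic relation: the number of `t ∈ {1,2}` with
`κ_t = j`. -/
def cycDeg (j : ZMod e) : ℕ := (if κ₁ = j then 1 else 0) + (if κ₂ = j then 1 else 0)

/-- The defining relations of the cyclotomic KLR algebra `H_n^Λ` (for quantum
characteristic `e ≥ 3`), together with relations killing the out-of-range generators. -/
inductive Rel : FreeH F e n → FreeH F e n → Prop
  | idem (i j : Fin n → ZMod e) :
      Rel (fE F e n i * fE F e n j) (if i = j then fE F e n i else 0)
  | sum : Rel (∑ i : Fin n → ZMod e, fE F e n i) 1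
  | yE (r : ℕ) (i : Fin n → ZMod e) :
      Rel (fY F e n r * fE F e n i) (fE F e n i * fY F e n r)
  | psiE (r : ℕ) (i : Fin n → ZMod e) (h1 : 1 ≤ r) (h2 : r + 1 ≤ n) :
      Rel (fPsi F e n r * fE F e n i) (fE F e n (swapIdx e n r i) * fPsi F e n r)
  | yy (r s : ℕ) : Rel (fY F e n r * fY F e n s) (fY F e n s * fY F e n r)
  | psiY (r s : ℕ) (h1 : s ≠ r) (h2 : s ≠ r + 1) :
      Rel (fPsi F e n r * fY F e n s) (fY F e n s * fPsi F e n r)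
  | psiPsi (r s : ℕ) (h : r + 1 < s) :
      Rel (fPsi F e n r * fPsi F e n s) (fPsi F e n s * fPsi F e n r)
  | psiYup (r : ℕ) (i : Fin n → ZMod e) (h1 : 1 ≤ r) (h2 : r + 1 ≤ n) :
      Rel (fPsi F e n r * fY F e n (r + 1) * fE F e n i)
          ((fY F e n r * fPsi F e n r + fDelta F e n i r) * fE F e n i)
  | yPsiDown (r : ℕ) (i : Fin n → ZMod e) (h1 : 1 ≤ r) (h2 : r + 1 ≤ n) :
      Rel (fY F e n (r + 1) * fPsi F e n r * fE F e n i)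
          ((fPsi F e n r * fY F e n r + fDelta F e n i r) * fE F e n i)
  | psiSq (r : ℕ) (i : Fin n → ZMod e) (h1 : 1 ≤ r) (h2 : r + 1 ≤ n) :
      Rel (fPsi F e n r * fPsi F e n r * fE F e n i)
        ((if ent e n i (r + 1) = ent e n i r then 0
          else if ent e n i (r + 1) = ent e n i r + 1 then fY F e n (r + 1) - fY F e n r
          else if ent e n i (r + 1) = ent e n i r - 1 then fY F e n r - fY F e n (r + 1)
          else 1) * fE F e n i)
  | braid (r : ℕ) (i : Fin n → ZMod e) (h1 : 1 ≤ r) (h2 : r + 2 ≤ n) :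
      Rel (fPsi F e n r * fPsi F e n (r + 1) * fPsi F e n r * fE F e n i)
        ((fPsi F e n (r + 1) * fPsi F e n r * fPsi F e n (r + 1) +
          (if ent e n i (r + 2) = ent e n i r ∧ ent e n i (r + 1) = ent e n i r + 1
            then 1
            else if ent e n i (r + 2) = ent e n i r ∧ ent e n i (r + 1) = ent e n i r - 1
              then -1 else 0)) * fE F e n i)
  | cyc (i : Fin n → ZMod e) :
      Rel (fY F e n 1 ^ cycDeg e κ₁ κ₂ (ent e n i 1) * fE F e n i) 0
  | yRange (r : ℕ) (h : r = 0 ∨ n < r) : Rel (fY F e n r) 0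
  | psiRange (r : ℕ) (h : r = 0 ∨ n ≤ r) : Rel (fPsi F e n r) 0

/-- The cyclotomic Khovanov--Lauda--Rouquier algebra `H = H_n^Λ` for the level-two
multicharge `κ = (κ₁, κ₂)`. -/
abbrev H := RingQuot (Rel F e n κ₁ κ₂)

/-- The idempotent generator `e(i)` of `H`. -/
def eIdem (i : Fin n → ZMod e) : H F e n κ₁ κ₂ :=
  RingQuot.mkAlgHom F (Rel F e n κ₁ κ₂) (fE F e n i)

/-- The generator `y_r` of `H`. -/
def y (r : ℕ) : H F e n κ₁ κ₂ := RingQuot.mkAlgHom F (Rel F e n κ₁ κ₂) (fY F e n r)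

/-- The generator `ψ_r` of `H`. -/
def ψgen (r : ℕ) : H F e n κ₁ κ₂ := RingQuot.mkAlgHom F (Rel F e n κ₁ κ₂) (fPsi F e n r)

/-- `Ψ(j↓i) = ψ_j ψ_{j-1} ⋯ ψ_i` (equal to `1` when `j < i`). -/
def Psid (j i : ℕ) : H F e n κ₁ κ₂ :=
  ((List.range (j + 1 - i)).map fun t => ψgen F e n κ₁ κ₂ (j - t)).prod

/-- `Ψ(i↑j) = ψ_i ψ_{i+1} ⋯ ψ_j` (equal to `1` when `j < i`). -/
def Psiu (i j : ℕ) : H F e n κ₁ κ₂ :=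
  ((List.range (j + 1 - i)).map fun t => ψgen F e n κ₁ κ₂ (i + t)).prod

/-- The residue sequence `i_λ` of the column-initial tableau of the hook bipartition
`((n-m), (1^m))`: `(κ₂, κ₂-1, …, κ₂-m+1, κ₁, κ₁+1, …, κ₁+n-m-1)`. -/
def iLam (m : ℕ) : Fin n → ZMod e := fun k =>
  if (k : ℕ) < m then κ₂ - ((k : ℕ) : ZMod e) else κ₁ + (((k : ℕ) - m : ℕ) : ZMod e)

/-- The residue sequence `(κ, κ-1, …, κ-m, κ+1, κ+2, …, κ+n-m-1)` of the column-initial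
tableau of a hook partition `(n-m, 1^m)` placed in a component with residue `κ` for its
first node. -/
def colIdx (κ : ZMod e) (m : ℕ) : Fin n → ZMod e := fun k =>
  if (k : ℕ) ≤ m then κ - ((k : ℕ) : ZMod e) else κ + (((k : ℕ) - m : ℕ) : ZMod e)

/-- The defining relation elements of the Specht module `S_{((n-m),(1^m))}`. -/
def hookRels (m : ℕ) : Set (H F e n κ₁ κ₂) :=
  {x | x = 1 - eIdem F e n κ₁ κ₂ (iLam e n κ₁ κ₂ m)} ∪
  {x | ∃ r, 1 ≤ r ∧ r ≤ n ∧ x = y F e n κ₁ κ₂ r} ∪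
  {x | ∃ r, 1 ≤ r ∧ r ≤ n - 1 ∧ r ≠ m ∧ x = ψgen F e n κ₁ κ₂ r}

/-- The Specht module `S_m = S_{((n-m),(1^m))}`: the cyclic `H`-module generated by `z_m`
subject only to the defining relations. -/
abbrev Sp (m : ℕ) :=
  H F e n κ₁ κ₂ ⧸ Submodule.span (H F e n κ₁ κ₂) (hookRels F e n κ₁ κ₂ m)

/-- The standard generator `z_m` of `S_{((n-m),(1^m))}`. -/
def z (m : ℕ) : Sp F e n κ₁ κ₂ m := Submodule.Quotient.mk (1 : H F e n κ₁ κ₂)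

/-- The defining relation elements of the Specht module `S'_m = S_{((n-m,1^m),∅)}`. -/
def armRels (m : ℕ) : Set (H F e n κ₁ κ₂) :=
  {x | x = 1 - eIdem F e n κ₁ κ₂ (colIdx e n κ₁ m)} ∪
  {x | ∃ r, 1 ≤ r ∧ r ≤ n ∧ x = y F e n κ₁ κ₂ r} ∪
  {x | ∃ r, 1 ≤ r ∧ r ≤ n - 1 ∧ r ≠ m + 1 ∧ x = ψgen F e n κ₁ κ₂ r} ∪
  {x | x = Psiu F e n κ₁ κ₂ 1 (m + 1)}

/-- The Specht module `S'_m = S_{((n-m,1^m),∅)}`. -/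
abbrev SpA (m : ℕ) :=
  H F e n κ₁ κ₂ ⧸ Submodule.span (H F e n κ₁ κ₂) (armRels F e n κ₁ κ₂ m)

/-- The standard generator `z'_m` of `S_{((n-m,1^m),∅)}`. -/
def zA (m : ℕ) : SpA F e n κ₁ κ₂ m := Submodule.Quotient.mk (1 : H F e n κ₁ κ₂)

/-- The defining relation elements of the Specht module `S''_m = S_{(∅,(n-m,1^m))}`. -/
def legRels (m : ℕ) : Set (H F e n κ₁ κ₂) :=
  {x | x = 1 - eIdem F e n κ₁ κ₂ (colIdx e n κ₂ m)} ∪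
  {x | ∃ r, 1 ≤ r ∧ r ≤ n ∧ x = y F e n κ₁ κ₂ r} ∪
  {x | ∃ r, 1 ≤ r ∧ r ≤ n - 1 ∧ r ≠ m + 1 ∧ x = ψgen F e n κ₁ κ₂ r} ∪
  {x | x = Psiu F e n κ₁ κ₂ 1 (m + 1)}

/-- The Specht module `S''_m = S_{(∅,(n-m,1^m))}`. -/
abbrev SpB (m : ℕ) :=
  H F e n κ₁ κ₂ ⧸ Submodule.span (H F e n κ₁ κ₂) (legRels F e n κ₁ κ₂ m)

/-- The standard generator `z''_m` of `S_{(∅,(n-m,1^m))}`. -/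
def zB (m : ℕ) : SpB F e n κ₁ κ₂ m := Submodule.Quotient.mk (1 : H F e n κ₁ κ₂)

/-- The standard basis vector `v(a₁,…,a_m) = Ψ(a₁-1↓1) Ψ(a₂-1↓2) ⋯ Ψ(a_m-1↓m) ⬝ z_m` of
`S_{((n-m),(1^m))}`, where `a k` is the 1-indexed entry `a_{k+1}` of the leg. -/
def v (m : ℕ) (a : Fin m → ℕ) : Sp F e n κ₁ κ₂ m :=
  (((List.finRange m).map fun k => Psid F e n κ₁ κ₂ (a k - 1) ((k : ℕ) + 1)).prod)
    • z F e n κ₁ κ₂ m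

/-- `a` records the leg entries `1 ≤ a₁ < a₂ < ⋯ < a_m ≤ n` of a standard
`((n-m),(1^m))`-tableau. -/
def StdLeg (m : ℕ) (a : Fin m → ℕ) : Prop :=
  StrictMono a ∧ (∀ k, 1 ≤ a k) ∧ ∀ k, a k ≤ n

/-- A nonzero scalar multiple of a nonempty product of the generators `ψ_1, …, ψ_{n-1}`. -/
def IsPsiWord (x : H F e n κ₁ κ₂) : Prop :=
  ∃ (c : F) (L : List ℕ), c ≠ 0 ∧ L ≠ [] ∧ (∀ r ∈ L, 1 ≤ r ∧ r ≤ n - 1) ∧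
    x = c • (L.map (ψgen F e n κ₁ κ₂)).prod

/-- The leg `(1, 2, …, m, n)` of the standard tableau labelling `v(1,…,m,n)`. -/
def gamTuple (m : ℕ) : Fin (m + 1) → ℕ := fun k => if (k : ℕ) < m then (k : ℕ) + 1 else n


section Relations

variable {F e n κ₁ κ₂}

theorem psiu_smul_step {i m : ℕ} (him : i ≤ m) (x : Sp F e n κ₁ κ₂ m) :
    Psiu F e n κ₁ κ₂ i m • x = ψgen F e n κ₁ κ₂ i • Psiu F e n κ₁ κ₂ (i + 1) m • x := by
  have hlen : m + 1 - i = (m + 1 - (i + 1)) + 1 := by omega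
  have hcongr : (fun t => ψgen F e n κ₁ κ₂ (i + (t + 1))) =
      fun t => ψgen F e n κ₁ κ₂ (i + 1 + t) := by
    funext t; congr 1; omega
  rw [← mul_smul]
  congr 1
  simp only [Psiu]
  rw [hlen, List.range_succ_eq_map]
  simp only [List.map_cons, List.prod_cons, List.map_map, Function.comp_def, Nat.succ_eq_add_one,
    add_zero, hcongr]

theorem psiu_of_lt {i m : ℕ} (h : m < i) : Psiu F e n κ₁ κ₂ i m = 1 := by
  simp [Psiu, Nat.sub_eq_zero_of_le (show m + 1 ≤ i by omega)]

theorem psi_mul_eIdem {r : ℕ} (h1 : 1 ≤ r) (h2 : r + 1 ≤ n) (j : Fin n → ZMod e) :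
    ψgen F e n κ₁ κ₂ r * eIdem F e n κ₁ κ₂ j =
      eIdem F e n κ₁ κ₂ (swapIdx e n r j) * ψgen F e n κ₁ κ₂ r := by
  simpa [ψgen, eIdem] using
    RingQuot.mkAlgHom_rel F (Rel.psiE (F := F) (κ₁ := κ₁) (κ₂ := κ₂) r j h1 h2)

theorem psi_mul_y_succ {r : ℕ} (h1 : 1 ≤ r) (h2 : r + 1 ≤ n) (j : Fin n → ZMod e) :
    ψgen F e n κ₁ κ₂ r * y F e n κ₁ κ₂ (r + 1) * eIdem F e n κ₁ κ₂ j =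
      (y F e n κ₁ κ₂ r * ψgen F e n κ₁ κ₂ r +
        if ent e n j r = ent e n j (r + 1) then 1 else 0) * eIdem F e n κ₁ κ₂ j := by
  have := RingQuot.mkAlgHom_rel F (Rel.psiYup (F := F) (κ₁ := κ₁) (κ₂ := κ₂) r j h1 h2)
  simpa [ψgen, eIdem, y, fDelta, apply_ite] using this

theorem psi_mul_psi_of_lt {r s : ℕ} (h : r + 1 < s) :
    ψgen F e n κ₁ κ₂ r * ψgen F e n κ₁ κ₂ s = ψgen F e n κ₁ κ₂ s * ψgen F e n κ₁ κ₂ r := by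
  simpa [ψgen] using
    RingQuot.mkAlgHom_rel F (Rel.psiPsi (e := e) (n := n) (F := F) (κ₁ := κ₁) (κ₂ := κ₂) r s h)

theorem psi_eq_zero_of_le {r : ℕ} (h : n ≤ r) : ψgen F e n κ₁ κ₂ r = 0 := by
  simpa [ψgen] using
    RingQuot.mkAlgHom_rel F (Rel.psiRange (e := e) (n := n) (F := F) (κ₁ := κ₁) (κ₂ := κ₂) r (.inr h))

theorem smul_z_eq_zero {m : ℕ} {x : H F e n κ₁ κ₂} (hx : x ∈ hookRels F e n κ₁ κ₂ m) :
    x • z F e n κ₁ κ₂ m = 0 := by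
  rw [z, ← Submodule.Quotient.mk_smul, smul_eq_mul, mul_one, Submodule.Quotient.mk_eq_zero]
  exact Submodule.subset_span hx

theorem y_smul_z {m r : ℕ} (h1 : 1 ≤ r) (h2 : r ≤ n) :
    y F e n κ₁ κ₂ r • z F e n κ₁ κ₂ m = 0 :=
  smul_z_eq_zero (.inl (.inr ⟨r, h1, h2, rfl⟩))

theorem psi_smul_z {m r : ℕ} (h1 : 1 ≤ r) (h2 : r + 1 ≤ n) (hr : r ≠ m) :
    ψgen F e n κ₁ κ₂ r • z F e n κ₁ κ₂ m = 0 :=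
  smul_z_eq_zero (.inr ⟨r, h1, by omega, hr, rfl⟩)

theorem eIdem_smul_z (m : ℕ) :
    eIdem F e n κ₁ κ₂ (iLam e n κ₁ κ₂ m) • z F e n κ₁ κ₂ m = z F e n κ₁ κ₂ m := by
  have h := smul_z_eq_zero (F := F) (n := n) (κ₁ := κ₁) (κ₂ := κ₂) (m := m)
    (x := 1 - eIdem F e n κ₁ κ₂ (iLam e n κ₁ κ₂ m)) (.inl (.inl rfl))
  rw [sub_smul, one_smul, sub_eq_zero] at h
  exact h.symm

theorem ent_swapIdx_self {e n r : ℕ} (h1 : 1 ≤ r) (h2 : r + 1 ≤ n) (j : Fin n → ZMod e) :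
    ent e n (swapIdx e n r j) r = ent e n j (r + 1) := by
  rw [ent, dif_pos ⟨h1, by omega⟩, swapIdx, if_pos (by simp only; omega)]

theorem ent_swapIdx_of_lt {e n r k : ℕ} (hk : k < r) (j : Fin n → ZMod e) :
    ent e n (swapIdx e n r j) k = ent e n j k := by
  simp only [ent]
  split_ifs with h
  · rw [swapIdx, if_neg (by simp only; omega), if_neg (by simp only; omega)]
  · rfl

/-- The residues in the first `r` positions of the weight of `ψ_r ψ_{r+1} ⋯ ψ_m z_m`. -/
theorem exists_weight_psiu_smul_z {m : ℕ} (hm : m < n) {r : ℕ} (h1 : 1 ≤ r) (hr : r ≤ m + 1) :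
    ∃ j : Fin n → ZMod e,
      eIdem F e n κ₁ κ₂ j • Psiu F e n κ₁ κ₂ r m • z F e n κ₁ κ₂ m =
        Psiu F e n κ₁ κ₂ r m • z F e n κ₁ κ₂ m ∧
      ent e n j r = κ₁ ∧ ∀ k, 1 ≤ k → k < r → ent e n j k = κ₂ - (k : ZMod e) + 1 := by
  induction hr using Nat.decreasingInduction with
  | self =>
    refine ⟨iLam e n κ₁ κ₂ m, ?_, ?_, fun k hk hkr => ?_⟩
    · rw [psiu_of_lt (Nat.lt_succ_self m), one_smul, eIdem_smul_z]
    · simp [ent, iLam, Nat.succ_le_of_lt hm]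
    · rw [ent, dif_pos ⟨hk, by omega⟩, iLam, if_pos (by simp only; omega)]
      push_cast [Nat.cast_sub hk]
      ring
  | of_succ r hr ih =>
    obtain ⟨j, hj, hjr, hjk⟩ := ih (by omega)
    refine ⟨swapIdx e n r j, ?_, ?_, fun k hk hkr => ?_⟩
    · rw [psiu_smul_step (by omega), ← mul_smul, ← psi_mul_eIdem h1 (by omega), mul_smul, hj]
    · rw [ent_swapIdx_self h1 (by omega), hjr]
    · rw [ent_swapIdx_of_lt hkr, hjk k hk (by omega)]

theorem psi_smul_psiu_smul_z {m r s : ℕ} (hm : m < n) (h1 : 1 ≤ r) (hrm : r < m)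
    (hrs : r + 1 < s) (hs : s ≤ m + 1) :
    ψgen F e n κ₁ κ₂ r • Psiu F e n κ₁ κ₂ s m • z F e n κ₁ κ₂ m = 0 := by
  induction hs using Nat.decreasingInduction with
  | self => rw [psiu_of_lt (Nat.lt_succ_self m), one_smul, psi_smul_z h1 (by omega) hrm.ne]
  | of_succ s hs ih =>
    rw [psiu_smul_step (by omega), ← mul_smul, psi_mul_psi_of_lt hrs, mul_smul,
      ih (by omega), smul_zero]

/-- Moving `y_r` past `ψ_r` in `y_r ψ_r ψ_{r+1} ⋯ ψ_m z_m`. -/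
theorem y_smul_psiu_smul_z {m r : ℕ} (hm : m < n) (h1 : 1 ≤ r) (hr : r ≤ m) :
    y F e n κ₁ κ₂ r • Psiu F e n κ₁ κ₂ r m • z F e n κ₁ κ₂ m =
      ψgen F e n κ₁ κ₂ r • y F e n κ₁ κ₂ (r + 1) •
          Psiu F e n κ₁ κ₂ (r + 1) m • z F e n κ₁ κ₂ m -
        if (r : ZMod e) = κ₂ - κ₁ + 1 then Psiu F e n κ₁ κ₂ (r + 1) m • z F e n κ₁ κ₂ m
        else 0 := by
  obtain ⟨j, hj, hjr, hjk⟩ := exists_weight_psiu_smul_z (F := F) (κ₁ := κ₁) (κ₂ := κ₂) hm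
    (r := r + 1) (by omega) (by omega)
  have h := congrArg (· • Psiu F e n κ₁ κ₂ (r + 1) m • z F e n κ₁ κ₂ m)
    (psi_mul_y_succ (F := F) (κ₁ := κ₁) (κ₂ := κ₂) h1 (by omega) j)
  have hiff : κ₂ - (r : ZMod e) + 1 = κ₁ ↔ (r : ZMod e) = κ₂ - κ₁ + 1 :=
    ⟨fun h => by rw [← h]; ring, fun h => by rw [h]; ring⟩
  simp only [mul_smul, hj, add_smul, ite_smul, one_smul, zero_smul, hjr, hjk r h1 r.lt_succ_self,
    hiff] at h
  rw [psiu_smul_step hr, h, add_sub_cancel_right]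

end Relations

/-- Lemma 5.7 of the paper: if `i ≢ κ₂ - κ₁ + 1 (mod e)` and `i ≤ m` then
`y_i ψ_i ψ_{i+1} ⋯ ψ_m z_m = 0` in `S_{((n-m),(1^m))}`. -/
theorem statement1 (F : Type*) [Field F] (e n : ℕ) [NeZero e] (he : 3 ≤ e) (hn : 1 ≤ n)
    (κ₁ κ₂ : ZMod e) (m : ℕ) (hm : m ≤ n) (i : ℕ) (hi1 : 1 ≤ i) (hi2 : i ≤ m)
    (h : (i : ZMod e) ≠ κ₂ - κ₁ + 1) :
    (y F e n κ₁ κ₂ i * Psiu F e n κ₁ κ₂ i m) • z F e n κ₁ κ₂ m = 0 := by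
  rw [mul_smul]
  obtain rfl | hmn := hm.eq_or_lt
  · have hzero : Psiu F e m κ₁ κ₂ i m = 0 :=
      List.prod_eq_zero (List.mem_map.2 ⟨m - i, List.mem_range.2 (by omega),
        psi_eq_zero_of_le (by omega)⟩)
    rw [hzero, zero_smul, smul_zero]
  have key : ∀ r, 1 ≤ r → r ≤ m + 1 → (r = m + 1 ∨ (r : ZMod e) ≠ κ₂ - κ₁ + 1) →
      y F e n κ₁ κ₂ r • Psiu F e n κ₁ κ₂ r m • z F e n κ₁ κ₂ m = 0 := by
    intro r h1 hr
    induction r using Nat.strong_decreasing_induction with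
    | base => exact ⟨m + 1, fun r hlt _ hle => absurd hle (by omega)⟩
    | step r ih =>
      intro hne
      obtain rfl | hlt := hr.eq_or_lt
      · rw [psiu_of_lt (Nat.lt_succ_self m), one_smul, y_smul_z h1 (by omega)]
      rw [y_smul_psiu_smul_z hmn h1 (by omega), if_neg (hne.resolve_left hlt.ne), sub_zero]
      by_cases hnext : r + 1 = m + 1 ∨ ((r + 1 : ℕ) : ZMod e) ≠ κ₂ - κ₁ + 1
      · rw [ih (r + 1) (by omega) (by omega) (by omega) hnext, smul_zero]
      push Not at hnext
      have : Fact (1 < e) := ⟨by omega⟩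
      have hnext' : ((r + 1 + 1 : ℕ) : ZMod e) ≠ κ₂ - κ₁ + 1 := by
        rw [Nat.cast_succ, hnext.2]
        simp
      rw [y_smul_psiu_smul_z hmn (by omega) (by omega), if_pos hnext.2,
        ih (r + 1 + 1) (by omega) (by omega) (by omega) (.inr hnext'), smul_zero, zero_sub,
        smul_neg, psi_smul_psiu_smul_z hmn h1 (by omega) (by omega) (by omega), neg_zero]
  exact key i hi1 (by omega) (.inr h)

end KLRHook
end

section
/- Suppose κ₂ = κ₁−1 in I and the image of n in I is 0 (so that in particular the image of n in I equals κ₂−κ₁+1 and all the homomorphisms γ, χ, τ, α, β, φ are defined). Then: (1) β_{m−1}∘τ_m = τ_{m+1}∘γ_m as homomorphisms S_m → S″_m, for every 1 ≤ m ≤ n−1; and (2) γ_m∘χ_m = χ_{m+1}∘α_m = φ_{m+1} as homomorphisms S′_m → S_{m+1}, for every 1 ≤ m ≤ n−2. -/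
namespace KLRHook

variable (F : Type*) [Field F] (e n : ℕ) [NeZero e] (κ₁ κ₂ : ZMod e)

section Words

variable (F : Type*) [Field F] (e n : ℕ) [NeZero e] (κ₁ κ₂ : ZMod e)

theorem commute_ψgen {r s : ℕ} (h : r + 1 < s) :
    Commute (ψgen F e n κ₁ κ₂ r) (ψgen F e n κ₁ κ₂ s) := by
  have key := RingQuot.mkAlgHom_rel F (Rel.psiPsi (F := F) (e := e) (n := n)
    (κ₁ := κ₁) (κ₂ := κ₂) r s h)
  rw [map_mul, map_mul] at key
  exact key

theorem commute_Psiu_Psid {i j k l : ℕ} (h : j + 1 < k) :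
    Commute (Psiu F e n κ₁ κ₂ i j) (Psid F e n κ₁ κ₂ l k) := by
  refine Commute.list_prod_left _ _ fun a ha => Commute.list_prod_right _ _ fun b hb => ?_
  simp only [List.mem_map, List.mem_range] at ha hb
  obtain ⟨s, hs, rfl⟩ := ha
  obtain ⟨t, ht, rfl⟩ := hb
  exact commute_ψgen F e n κ₁ κ₂ (by omega)

theorem Psid_eq_one {i j : ℕ} (h : j < i) : Psid F e n κ₁ κ₂ j i = 1 := by
  simp [Psid, Nat.sub_eq_zero_of_le (Nat.succ_le_of_lt h)]

theorem Psid_succ_mul_ψgen {i j : ℕ} (h : i ≤ j) :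
    Psid F e n κ₁ κ₂ j (i + 1) * ψgen F e n κ₁ κ₂ i = Psid F e n κ₁ κ₂ j i := by
  obtain ⟨d, rfl⟩ := Nat.exists_eq_add_of_le h
  have h1 : i + d + 1 - (i + 1) = d := by omega
  have h2 : i + d + 1 - i = d + 1 := by omega
  simp [Psid, h1, h2, List.range_succ]

theorem Psiu_one_mul_ψgen (m : ℕ) :
    Psiu F e n κ₁ κ₂ 1 m * ψgen F e n κ₁ κ₂ (m + 1) = Psiu F e n κ₁ κ₂ 1 (m + 1) := by
  simp [Psiu, List.range_succ, add_comm]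

theorem v_gamTuple (m : ℕ) :
    v F e n κ₁ κ₂ (m + 1) (gamTuple n m) =
      Psid F e n κ₁ κ₂ (n - 1) (m + 1) • z F e n κ₁ κ₂ (m + 1) := by
  have h : ((List.finRange m).map fun k : Fin m =>
      Psid F e n κ₁ κ₂ (gamTuple n m k.castSucc - 1) ((k.castSucc : ℕ) + 1)).prod = 1 := by
    refine List.prod_eq_one fun x hx => ?_
    simp only [List.mem_map] at hx
    obtain ⟨k, -, rfl⟩ := hx
    exact Psid_eq_one F e n κ₁ κ₂ (by simp [gamTuple])
  rw [v, List.finRange_succ_last, List.map_append, List.prod_append, List.map_map]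
  simp only [Function.comp_def]
  rw [h]
  simp [gamTuple]

/-- A linear map out of a cyclic module is determined by its value at the generator. -/
theorem linearMap_ext_mk_one {R M : Type*} [Ring R] [AddCommGroup M] [Module R M]
    {I : Submodule R R} {f g : (R ⧸ I) →ₗ[R] M}
    (h : f (Submodule.Quotient.mk 1) = g (Submodule.Quotient.mk 1)) : f = g :=
  Submodule.linearMap_qext _ (LinearMap.ext_ring h)

end Words

/-- Lemma 5.11 of the paper: compositions of the Specht module
homomorphisms.  Part (1): `β_{m-1} ∘ τ_m = τ_{m+1} ∘ γ_m` for `1 ≤ m ≤ n-1` (stated here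
with `m` replaced by `m + 1`).  Part (2): `γ_m ∘ χ_m = χ_{m+1} ∘ α_m = φ_{m+1}` for
`1 ≤ m ≤ n-2`.  Each homomorphism is characterised by its (hypothesised) value on the
standard generator. -/
theorem statement6 (F : Type*) [Field F] (e n : ℕ) [NeZero e] (he : 3 ≤ e) (hn : 1 ≤ n)
    (κ₁ κ₂ : ZMod e) (hκ : κ₂ = κ₁ - 1) (hn0 : ((n : ℕ) : ZMod e) = 0) :
    (∀ m : ℕ, m + 1 ≤ n - 1 →
      ∀ (τm : Sp F e n κ₁ κ₂ (m + 1) →ₗ[H F e n κ₁ κ₂] SpB F e n κ₁ κ₂ m)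
        (βm : SpB F e n κ₁ κ₂ m →ₗ[H F e n κ₁ κ₂] SpB F e n κ₁ κ₂ (m + 1))
        (γm : Sp F e n κ₁ κ₂ (m + 1) →ₗ[H F e n κ₁ κ₂] Sp F e n κ₁ κ₂ (m + 2))
        (τm1 : Sp F e n κ₁ κ₂ (m + 2) →ₗ[H F e n κ₁ κ₂] SpB F e n κ₁ κ₂ (m + 1)),
        τm (z F e n κ₁ κ₂ (m + 1)) = zB F e n κ₁ κ₂ m →
        βm (zB F e n κ₁ κ₂ m) = Psid F e n κ₁ κ₂ (n - 1) (m + 2) • zB F e n κ₁ κ₂ (m + 1) →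
        γm (z F e n κ₁ κ₂ (m + 1)) = v F e n κ₁ κ₂ (m + 2) (gamTuple n (m + 1)) →
        τm1 (z F e n κ₁ κ₂ (m + 2)) = zB F e n κ₁ κ₂ (m + 1) →
        βm.comp τm = τm1.comp γm) ∧
    (∀ m : ℕ, 1 ≤ m → m ≤ n - 2 →
      ∀ (χm : SpA F e n κ₁ κ₂ m →ₗ[H F e n κ₁ κ₂] Sp F e n κ₁ κ₂ m)
        (γm : Sp F e n κ₁ κ₂ m →ₗ[H F e n κ₁ κ₂] Sp F e n κ₁ κ₂ (m + 1))
        (αm : SpA F e n κ₁ κ₂ m →ₗ[H F e n κ₁ κ₂] SpA F e n κ₁ κ₂ (m + 1))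
        (χm1 : SpA F e n κ₁ κ₂ (m + 1) →ₗ[H F e n κ₁ κ₂] Sp F e n κ₁ κ₂ (m + 1))
        (φm1 : SpA F e n κ₁ κ₂ m →ₗ[H F e n κ₁ κ₂] Sp F e n κ₁ κ₂ (m + 1)),
        χm (zA F e n κ₁ κ₂ m) = Psiu F e n κ₁ κ₂ 1 m • z F e n κ₁ κ₂ m →
        γm (z F e n κ₁ κ₂ m) = v F e n κ₁ κ₂ (m + 1) (gamTuple n m) →
        αm (zA F e n κ₁ κ₂ m) = Psid F e n κ₁ κ₂ (n - 1) (m + 2) • zA F e n κ₁ κ₂ (m + 1) →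
        χm1 (zA F e n κ₁ κ₂ (m + 1)) = Psiu F e n κ₁ κ₂ 1 (m + 1) • z F e n κ₁ κ₂ (m + 1) →
        φm1 (zA F e n κ₁ κ₂ m) =
            (Psiu F e n κ₁ κ₂ 1 m * Psid F e n κ₁ κ₂ (n - 1) (m + 1)) •
              z F e n κ₁ κ₂ (m + 1) →
        γm.comp χm = χm1.comp αm ∧ γm.comp χm = φm1) := by
  refine ⟨fun m _ τm βm γm τm1 hτ hβ hγ hτ1 => linearMap_ext_mk_one ?_,
    fun m _ hm χm γm αm χm1 φm1 hχ hγ hα hχ1 hφ => ?_⟩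
  · change βm (τm (z F e n κ₁ κ₂ (m + 1))) = τm1 (γm (z F e n κ₁ κ₂ (m + 1)))
    rw [hτ, hβ, hγ, v_gamTuple, map_smul, hτ1]
  · have hγχ : γm (χm (zA F e n κ₁ κ₂ m)) =
        (Psiu F e n κ₁ κ₂ 1 m * Psid F e n κ₁ κ₂ (n - 1) (m + 1)) •
          z F e n κ₁ κ₂ (m + 1) := by
      rw [hχ, map_smul, hγ, v_gamTuple, mul_smul]
    refine ⟨linearMap_ext_mk_one ?_, linearMap_ext_mk_one (hγχ.trans hφ.symm)⟩
    refine hγχ.trans ?_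
    change _ = χm1 (αm (zA F e n κ₁ κ₂ m))
    rw [hα, map_smul, hχ1, ← mul_smul, ← Psiu_one_mul_ψgen, ← mul_assoc,
      ← (commute_Psiu_Psid F e n κ₁ κ₂ (i := 1) (l := n - 1) (Nat.lt_succ_self (m + 1))).eq,
      mul_assoc, Psid_succ_mul_ψgen F e n κ₁ κ₂ (by omega)]

end KLRHook
end
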